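/- arXiv:2510.13071 — 2 statements merged into one kernel-verified Lean document; each statement's English description precedes it below -/
import Mathlib

section
/- Let N = (N_i)_{i≥0} be a reduced sequence of nonnegative real matrices with nonempty alphabets A_i of bounded cardinality. Then there exist finitely many reduced primitive proper streams α(1), …, α(d) and a further stream P (the pool stream) such that: (i) for every i the sets α(1)_i, …, α(d)_i, P_i partition A_i, and every α(j) is nonempty at all times from the maximum of the starting times on; (ii) for i ≠ j, if there is a front-connection from α(i) to α(j) then i < j; (iii) P contains no infinite vertex path; every p ∈ P_k admits a vertex path p = y_k, y_{k+1}, …, y_n with y_m ∈ P_m for k ≤ m < n and y_n ∈ α(j)_n for some j ≥ 2, but admits no such path with y_n ∈ α(1)_n; and whenever there is a vertex path from a vertex of α(i) to p with all intermediate vertices in P and a vertex path from p to a vertex of α(j) with all intermediate vertices in P, then i < j. Moreover (iv) the decomposition is eventually unique: if α'(1), …, α'(d'), P' is another such collection satisfying (i)–(iii), then d' = d and there exist m ≥ 0 and a permutation σ of {1,…,d} with α'(σ(j))_i = α(j)_i for all j and all i ≥ m, and hence P'_i = P_i for all i ≥ m. -/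
open Filter Topology Matrix

noncomputable section

/-- The product `N_k N_{k+1} ⋯ N_{k+m}` of a nonstationary sequence of matrices,
i.e. the matrix written `N_k^n` (with `n = k + m`) in the paper. -/
def matProd {A : ℕ → Type} [∀ i, Fintype (A i)]
    (N : ∀ i, Matrix (A i) (A (i + 1)) ℝ) (k : ℕ) :
    ∀ m : ℕ, Matrix (A k) (A (k + m + 1)) ℝ
  | 0 => N k
  | m + 1 => matProd N k m * N (k + m + 1)

/-- `V_N^0`: nonnegative fixed-point sequences (`w_i ∈ C_i`, `w_i = N_i w_{i+1}`). -/
def V0 {A : ℕ → Type} [∀ i, Fintype (A i)] (N : ∀ i, Matrix (A i) (A (i + 1)) ℝ) :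
    Set (∀ i, A i → ℝ) :=
  {w | (∀ i a, 0 ≤ w i a) ∧ ∀ i, w i = (N i).mulVec (w (i + 1))}

/-- `V_N`: nonnegative eigenvector sequences of eigenvalue one (never zero). -/
def Vpos {A : ℕ → Type} [∀ i, Fintype (A i)] (N : ∀ i, Matrix (A i) (A (i + 1)) ℝ) :
    Set (∀ i, A i → ℝ) := {w | w ∈ V0 N ∧ ∀ i, w i ≠ 0}

/-- `V_N^Δ`: members of `V_N` whose initial vector lies in the unit simplex `Δ₀`
(for the `L¹` norm `‖u‖ = ∑ₐ |u a|`). -/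
def VDelta {A : ℕ → Type} [∀ i, Fintype (A i)] (N : ∀ i, Matrix (A i) (A (i + 1)) ℝ) :
    Set (∀ i, A i → ℝ) := {w | w ∈ Vpos N ∧ ∑ a, |w 0 a| = 1}

/-- The sequence `N` is primitive: for every `k` there is `n > k` (here `n = k + m`, `m ≥ 1`)
such that every entry of `N_k^n` is strictly positive. -/
def Primitive {A : ℕ → Type} [∀ i, Fintype (A i)] (N : ∀ i, Matrix (A i) (A (i + 1)) ℝ) : Prop :=
  ∀ k, ∃ m, 0 < m ∧ ∀ (a : A k) (b : A (k + m + 1)), 0 < matProd N k m a b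

/-- The submatrix sequence of `N` determined by a stream `α` (a sequence of sub-alphabets). -/
def subMat {A : ℕ → Type} (N : ∀ i, Matrix (A i) (A (i + 1)) ℝ) (α : ∀ i, Finset (A i)) :
    ∀ i, Matrix (↥(α i)) (↥(α (i + 1))) ℝ :=
  fun i => Matrix.of fun a b => N i a.1 b.1

/-- A stream is proper with starting time `k`: empty before `k`, nonempty from `k` on. -/
def StreamProper {A : ℕ → Type} (α : ∀ i, Finset (A i)) (k : ℕ) : Prop :=
  (∀ i, i < k → α i = ∅) ∧ ∀ i, k ≤ i → (α i).Nonempty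

/-- A stream is reduced (from time `k` on): its submatrix sequence has no all-zero row
or column. -/
def StreamReduced {A : ℕ → Type} (N : ∀ i, Matrix (A i) (A (i + 1)) ℝ)
    (α : ∀ i, Finset (A i)) (k : ℕ) : Prop :=
  ∀ i, k ≤ i →
    (∀ a : ↥(α i), ∃ b : ↥(α (i + 1)), subMat N α i a b ≠ 0) ∧
    (∀ b : ↥(α (i + 1)), ∃ a : ↥(α i), subMat N α i a b ≠ 0)

/-- A stream is primitive (from time `k` on): its submatrix sequence is primitive. -/
def StreamPrimitive {A : ℕ → Type} [∀ i, Fintype (A i)]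
    (N : ∀ i, Matrix (A i) (A (i + 1)) ℝ) (α : ∀ i, Finset (A i)) (k : ℕ) : Prop :=
  ∀ j, k ≤ j → ∃ m, 0 < m ∧ ∀ (a : ↥(α j)) (b : ↥(α (j + m + 1))),
    0 < matProd (A := fun i => ↥(α i)) (subMat N α) j m a b

/-- There is a front-connection from stream `α` to stream `β`: a vertex path
`x_k, y_{k+1}, …, y_{n-1}, x_n` with `x_k ∈ α_k`, `x_n ∈ β_n` and all intermediate
vertices outside `α ∪ β`. -/
def FrontConn {A : ℕ → Type} (N : ∀ i, Matrix (A i) (A (i + 1)) ℝ)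
    (α β : ∀ i, Finset (A i)) : Prop :=
  ∃ (k n : ℕ) (x : ∀ i, A i), k < n ∧ x k ∈ α k ∧ x n ∈ β n ∧
    (∀ i, k ≤ i → i < n → 0 < N i (x i) (x (i + 1))) ∧
    (∀ i, k < i → i < n → x i ∉ α i ∧ x i ∉ β i)

/-- The pool stream `P` contains no infinite vertex path. -/
def PoolNoInfPath {A : ℕ → Type} (N : ∀ i, Matrix (A i) (A (i + 1)) ℝ)
    (P : ∀ i, Finset (A i)) : Prop :=
  ¬ ∃ (k : ℕ) (x : ∀ i, A i),
      (∀ i, k ≤ i → x i ∈ P i) ∧ ∀ i, k ≤ i → 0 < N i (x i) (x (i + 1))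

/-- A vertex path `p = y_k, …, y_n` from a pool element `p` with `y_m ∈ P_m` for
`k ≤ m < n` and `y_n ∈ β_n`. -/
def PoolExit {A : ℕ → Type} (N : ∀ i, Matrix (A i) (A (i + 1)) ℝ)
    (P : ∀ i, Finset (A i)) (β : ∀ i, Finset (A i)) (k : ℕ) (p : A k) : Prop :=
  ∃ (n : ℕ) (x : ∀ i, A i), k < n ∧ x k = p ∧
    (∀ m, k ≤ m → m < n → x m ∈ P m) ∧
    (∀ i, k ≤ i → i < n → 0 < N i (x i) (x (i + 1))) ∧ x n ∈ β n

/-- A vertex path from a vertex of `β` to the pool element `p` with all intermediate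
vertices in `P`. -/
def PoolEnter {A : ℕ → Type} (N : ∀ i, Matrix (A i) (A (i + 1)) ℝ)
    (P : ∀ i, Finset (A i)) (β : ∀ i, Finset (A i)) (k : ℕ) (p : A k) : Prop :=
  ∃ (k' : ℕ) (x : ∀ i, A i), k' < k ∧ x k' ∈ β k' ∧ x k = p ∧
    (∀ m, k' < m → m < k → x m ∈ P m) ∧
    ∀ i, k' ≤ i → i < k → 0 < N i (x i) (x (i + 1))

/-- Conditions (i)–(iii) of the stream decomposition theorem, for reduced primitive proper
streams `α 0 < α 1 < ⋯ < α (d-1)` (`0`-indexed, so the paper's `α(1)` is `α 0` and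
"`j ≥ 2`" is "`0 < j`") together with the pool stream `P`. -/
def StreamDecomp {A : ℕ → Type} [∀ i, Fintype (A i)]
    (N : ∀ i, Matrix (A i) (A (i + 1)) ℝ)
    (d : ℕ) (α : Fin d → ∀ i, Finset (A i)) (P : ∀ i, Finset (A i))
    (t : Fin d → ℕ) : Prop :=
  -- the α j are reduced primitive proper streams
  (∀ j, StreamProper (α j) (t j) ∧ StreamReduced N (α j) (t j) ∧
    StreamPrimitive N (α j) (t j)) ∧
  -- (i): for every i, the sets α(1)_i, …, α(d)_i, P_i partition A_i
  (∀ i (a : A i), (a ∈ P i ∧ ∀ j, a ∉ α j i) ∨ (a ∉ P i ∧ ∃! j, a ∈ α j i)) ∧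
  -- (ii): front-connections only go forward in the order
  (∀ j j' : Fin d, j ≠ j' → FrontConn N (α j) (α j') → j < j') ∧
  -- (iii): pool conditions
  PoolNoInfPath N P ∧
  (∀ (k : ℕ) (p : A k), p ∈ P k →
    (∃ j : Fin d, 0 < (j : ℕ) ∧ PoolExit N P (α j) k p) ∧
    (∀ j : Fin d, (j : ℕ) = 0 → ¬ PoolExit N P (α j) k p) ∧
    (∀ j j' : Fin d, PoolEnter N P (α j) k p → PoolExit N P (α j') k p → j < j'))

section Paths

variable {A : ℕ → Type} (N : ∀ i, Matrix (A i) (A (i + 1)) ℝ)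

/-- `x` is a vertex path between the times `k` and `n`. -/
def IsPathOn (x : ∀ i, A i) (k n : ℕ) : Prop :=
  ∀ i, k ≤ i → i < n → 0 < N i (x i) (x (i + 1))

/-- The vertex `b` at time `n` can be reached by a vertex path from `a` at time `k`. -/
def Reach (k : ℕ) (a : A k) (n : ℕ) (b : A n) : Prop :=
  k ≤ n ∧ ∃ x : ∀ i, A i, x k = a ∧ x n = b ∧ IsPathOn N x k n

variable {N}

theorem IsPathOn.reach {x : ∀ i, A i} {k n : ℕ} (h : IsPathOn N x k n) {i j : ℕ}
    (hki : k ≤ i) (hij : i ≤ j) (hjn : j ≤ n) : Reach N i (x i) j (x j) :=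
  ⟨hij, x, rfl, rfl, fun l h1 h2 => h l (hki.trans h1) (h2.trans_le hjn)⟩

theorem reach_of_path {x : ∀ i, A i} {k : ℕ}
    (h : ∀ i, k ≤ i → 0 < N i (x i) (x (i + 1))) {i j : ℕ}
    (hki : k ≤ i) (hij : i ≤ j) : Reach N i (x i) j (x j) :=
  ⟨hij, x, rfl, rfl, fun l h1 _ => h l (hki.trans h1)⟩

/-- Two paths that meet at time `n` can be spliced there. -/
theorem exists_splice {x y : ∀ i, A i} {n : ℕ} (hxy : x n = y n) :
    ∃ z : ∀ i, A i, (∀ i, i ≤ n → z i = x i) ∧ (∀ i, n ≤ i → z i = y i) := by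
  refine ⟨fun i => if i ≤ n then x i else y i, fun i hi => if_pos hi, fun i hi => ?_⟩
  rcases hi.eq_or_lt with rfl | h
  · simpa using hxy
  · exact if_neg (not_le.2 h)

theorem Reach.trans {k n m : ℕ} {a : A k} {b : A n} {c : A m}
    (h₁ : Reach N k a n b) (h₂ : Reach N n b m c) : Reach N k a m c := by
  obtain ⟨hkn, x, rfl, rfl, hx⟩ := h₁
  obtain ⟨hnm, y, hy, rfl, hyp⟩ := h₂
  obtain ⟨z, hz1, hz2⟩ := exists_splice hy.symm
  refine ⟨hkn.trans hnm, z, hz1 _ hkn, hz2 _ hnm, fun i h1 h2 => ?_⟩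
  rcases lt_or_ge i n with h | h
  · rw [hz1 i h.le, hz1 (i + 1) h]
    exact hx i h1 h
  · rw [hz2 i h, hz2 (i + 1) (by omega)]
    exact hyp i h h2

theorem reach_of_edge [∀ i, Nonempty (A i)] {k : ℕ} {a : A k} {b : A (k + 1)}
    (h : 0 < N k a b) : Reach N k a (k + 1) b := by
  classical
  refine ⟨k.le_succ, Function.update (Function.update (fun i => Classical.arbitrary _) k a)
    (k + 1) b, by simp, by simp, fun i h1 h2 => ?_⟩
  obtain rfl : i = k := by omega
  simpa using h

/-- König's lemma for paths in a sequence of finite alphabets. -/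
theorem exists_forall_of_forall_lt [∀ i, Finite (A i)] (Q : ∀ i, A i → A (i + 1) → Prop)
    (h : ∀ m, ∃ x : ∀ i, A i, ∀ i < m, Q i (x i) (x (i + 1))) :
    ∃ x : ∀ i, A i, ∀ i, Q i (x i) (x (i + 1)) := by
  let : ∀ i, TopologicalSpace (A i) := fun _ => ⊥
  have : ∀ i, DiscreteTopology (A i) := fun _ => ⟨rfl⟩
  have hclosed : ∀ m, IsClosed {x : ∀ i, A i | ∀ i < m, Q i (x i) (x (i + 1))} := fun m => by
    simp only [Set.ofPred_forall]
    refine isClosed_iInter fun i => isClosed_iInter fun _ => ?_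
    exact (isClosed_discrete {p : A i × A (i + 1) | Q i p.1 p.2}).preimage
      ((continuous_apply i).prodMk (continuous_apply (i + 1)))
  obtain ⟨x, hx⟩ := IsCompact.nonempty_iInter_of_sequence_nonempty_isCompact_isClosed
    (fun m => {x : ∀ i, A i | ∀ i < m, Q i (x i) (x (i + 1))})
    (fun m x hx i hi => hx i (by omega)) h (hclosed 0).isCompact hclosed
  exact ⟨x, fun i => Set.mem_iInter.1 hx (i + 1) i i.lt_succ_self⟩

/-- Following predecessors inside `S` back to time `k`. -/
theorem exists_path_to [∀ i, Nonempty (A i)] (S : ∀ i, A i → Prop) (k : ℕ)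
    (hS : ∀ i, k ≤ i → ∀ b, S (i + 1) b → ∃ a, S i a ∧ 0 < N i a b) {n : ℕ} (hkn : k ≤ n) :
    ∀ b : A n, S n b → ∃ x : ∀ i, A i, x n = b ∧ IsPathOn N x k n ∧
      ∀ i, k ≤ i → i ≤ n → S i (x i) := by
  classical
  induction n, hkn using Nat.le_induction with
  | base =>
    intro b hb
    refine ⟨Function.update (fun i => Classical.arbitrary _) k b, by simp,
      fun i h1 h2 => by omega, fun i h1 h2 => ?_⟩
    obtain rfl : i = k := by omega
    simpa using hb
  | succ n hkn ih =>
    intro b hb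
    obtain ⟨a, ha, hab⟩ := hS n hkn b hb
    obtain ⟨x, rfl, hx, hxS⟩ := ih a ha
    have hne : ∀ i, i ≤ n → Function.update x (n + 1) b i = x i := fun i hi =>
      Function.update_of_ne (by omega) _ _
    refine ⟨Function.update x (n + 1) b, by simp, fun i h1 h2 => ?_, fun i h1 h2 => ?_⟩
    · rcases (Nat.lt_succ_iff.1 h2).eq_or_lt with rfl | h
      · rw [hne _ le_rfl, Function.update_self]
        exact hab
      · rw [hne _ h.le, hne _ h]
        exact hx i h1 h
    · rcases h2.eq_or_lt with rfl | h
      · rwa [Function.update_self]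
      · rw [hne _ (Nat.lt_succ_iff.1 h)]
        exact hxS i h1 (Nat.lt_succ_iff.1 h)

/-- Following successors inside `S` from time `k` on. -/
theorem exists_path_from [∀ i, Nonempty (A i)] (S : ∀ i, A i → Prop) (k : ℕ)
    (hS : ∀ i, k ≤ i → ∀ a, S i a → ∃ b, S (i + 1) b ∧ 0 < N i a b) (a : A k) (ha : S k a) :
    ∃ x : ∀ i, A i, x k = a ∧ (∀ i, k ≤ i → 0 < N i (x i) (x (i + 1))) ∧
      ∀ i, k ≤ i → S i (x i) := by
  classical
  have hf : ∀ i (a : A i), ∃ b, k ≤ i → S i a → S (i + 1) b ∧ 0 < N i a b := fun i a => by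
    by_cases h : k ≤ i ∧ S i a
    · exact (hS i h.1 a h.2).imp fun b hb _ _ => hb
    · exact ⟨Classical.arbitrary _, fun h1 h2 => absurd ⟨h1, h2⟩ h⟩
  choose f hf using hf
  let z : ∀ i, A i := Function.update (fun i => Classical.arbitrary _) k a
  let x : ∀ i, A i := fun i =>
    Nat.rec (z 0) (fun i y => if i + 1 ≤ k then z (i + 1) else f i y) i
  have hxk : x k = a := by
    have hz : z k = a := by simp [z]
    cases k with
    | zero => exact hz
    | succ k => exact (if_pos le_rfl).trans hz
  have hxs : ∀ i, k ≤ i → x (i + 1) = f i (x i) := fun i hi => if_neg (by omega)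
  have hxS : ∀ i, k ≤ i → S i (x i) := fun i hi => by
    induction i, hi using Nat.le_induction with
    | base => rwa [hxk]
    | succ i hi ih =>
      rw [hxs i hi]
      exact (hf i (x i) hi ih).1
  refine ⟨x, hxk, fun i hi => ?_, hxS⟩
  rw [hxs i hi]
  exact (hf i (x i) hi (hxS i hi)).2

/-- If `S` is closed under taking some predecessor after time `k` and meets arbitrarily late
times, it contains an infinite path from time `k` on. -/
theorem exists_path_of_frequently [∀ i, Finite (A i)] [∀ i, Nonempty (A i)]
    (S : ∀ i, A i → Prop) (k : ℕ)
    (hS : ∀ i, k ≤ i → ∀ b, S (i + 1) b → ∃ a, S i a ∧ 0 < N i a b)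
    (hfreq : ∀ m, ∃ n, m ≤ n ∧ ∃ b, S n b) :
    ∃ x : ∀ i, A i, (∀ i, k ≤ i → 0 < N i (x i) (x (i + 1))) ∧ ∀ i, k ≤ i → S i (x i) := by
  obtain ⟨x, hx⟩ := exists_forall_of_forall_lt
    (fun i a b => k ≤ i → 0 < N i a b ∧ S i a) fun m => by
      obtain ⟨n, hn, b, hb⟩ := hfreq (max m k)
      obtain ⟨x, -, hx, hxS⟩ := exists_path_to S k hS (by omega : k ≤ n) b hb
      exact ⟨x, fun i hi hki => ⟨hx i hki (by omega), hxS i hki (by omega)⟩⟩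
  exact ⟨x, fun i hi => (hx i hi).1, fun i hi => (hx i hi).2⟩

end Paths

section Products

variable {A : ℕ → Type} {N : ∀ i, Matrix (A i) (A (i + 1)) ℝ}

theorem matProd_nonneg [∀ i, Fintype (A i)] (hN0 : ∀ i a b, 0 ≤ N i a b) (k m : ℕ) (a : A k)
    (b : A (k + m + 1)) : 0 ≤ matProd N k m a b := by
  induction m with
  | zero => exact hN0 _ _ _
  | succ m ih =>
    exact Finset.sum_nonneg fun c _ => mul_nonneg (ih c) (hN0 _ _ _)

/-- A matrix product has a positive entry exactly when some intermediate vertex has positive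
entries on both sides. -/
theorem matProd_succ_pos_iff [∀ i, Fintype (A i)] (hN0 : ∀ i a b, 0 ≤ N i a b) (k m : ℕ) (a : A k)
    (b : A (k + (m + 1) + 1)) :
    0 < matProd N k (m + 1) a b ↔ ∃ c, 0 < matProd N k m a c ∧ 0 < N (k + m + 1) c b := by
  have h0 : ∀ c ∈ Finset.univ, 0 ≤ matProd N k m a c * N (k + m + 1) c b := fun c _ =>
    mul_nonneg (matProd_nonneg hN0 k m a c) (hN0 _ _ _)
  have : matProd N k (m + 1) a b = ∑ c, matProd N k m a c * N (k + m + 1) c b := rfl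
  rw [this, Finset.sum_pos_iff_of_nonneg h0]
  refine exists_congr fun c => ?_
  simp only [Finset.mem_univ, true_and]
  constructor
  · intro h
    have h1 := matProd_nonneg hN0 k m a c
    have h2 := hN0 (k + m + 1) c b
    exact ⟨h1.lt_of_ne fun h' => by simp [← h'] at h, h2.lt_of_ne fun h' => by simp [← h'] at h⟩
  · rintro ⟨h1, h2⟩
    exact mul_pos h1 h2

theorem reach_of_matProd_subMat_pos [∀ i, Nonempty (A i)] (hN0 : ∀ i a b, 0 ≤ N i a b)
    {α : ∀ i, Finset (A i)} (k m : ℕ) (a : α k) (b : α (k + m + 1))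
    (h : 0 < matProd (A := fun i => ↥(α i)) (subMat N α) k m a b) :
    Reach N k a.1 (k + m + 1) b.1 := by
  induction m with
  | zero => exact reach_of_edge h
  | succ m ih =>
    obtain ⟨c, h1, h2⟩ :=
      (matProd_succ_pos_iff (A := fun i => ↥(α i)) (fun i _ _ => hN0 i _ _) k m a b).1 h
    exact (ih c h1).trans (reach_of_edge h2)

theorem matProd_subMat_pos (hN0 : ∀ i a b, 0 ≤ N i a b) {α : ∀ i, Finset (A i)} (k m : ℕ)
    (x : ∀ i, A i) (hx : IsPathOn N x k (k + m + 1))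
    (hxα : ∀ i, k ≤ i → i ≤ k + m + 1 → x i ∈ α i) :
    0 < matProd (A := fun i => ↥(α i)) (subMat N α) k m
      ⟨x k, hxα k le_rfl (by omega)⟩ ⟨x (k + m + 1), hxα _ (by omega) le_rfl⟩ := by
  induction m with
  | zero => exact hx k le_rfl (by omega)
  | succ m ih =>
    refine (matProd_succ_pos_iff (A := fun i => ↥(α i)) (fun i _ _ => hN0 i _ _) k m _ _).2
      ⟨⟨x (k + m + 1), hxα _ (by omega) (by omega)⟩, ?_, ?_⟩
    · exact ih (fun i h1 h2 => hx i h1 (by omega)) fun i h1 h2 => hxα i h1 (by omega)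
    · exact hx (k + m + 1) (by omega) (by omega)

end Products

/-- The last time before `p` at which `Q` holds. -/
theorem exists_last_lt {Q : ℕ → Prop} {k p : ℕ} (hkp : k < p) (hk : Q k) :
    ∃ l, k ≤ l ∧ l < p ∧ Q l ∧ ∀ m, l < m → m < p → ¬ Q m := by
  induction p, hkp using Nat.le_induction with
  | base => exact ⟨k, le_rfl, k.lt_succ_self, hk, fun m h1 h2 => by omega⟩
  | succ p hp ih =>
    by_cases hQ : Q p
    · exact ⟨p, by omega, p.lt_succ_self, hQ, fun m h1 h2 => by omega⟩
    · obtain ⟨l, h1, h2, h3, h4⟩ := ih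
      refine ⟨l, h1, by omega, h3, fun m h5 h6 => ?_⟩
      rcases (Nat.lt_succ_iff.1 h6).eq_or_lt with rfl | h
      · exact hQ
      · exact h4 m h5 h

/-- The first time from `p` on at which `Q` holds. -/
theorem exists_first_ge {Q : ℕ → Prop} {p n : ℕ} (hpn : p ≤ n) (hn : Q n) :
    ∃ l, p ≤ l ∧ l ≤ n ∧ Q l ∧ ∀ m, p ≤ m → m < l → ¬ Q m := by
  classical
  have h : ∃ l, p ≤ l ∧ Q l := ⟨n, hpn, hn⟩
  exact ⟨Nat.find h, (Nat.find_spec h).1, Nat.find_min' h ⟨hpn, hn⟩, (Nat.find_spec h).2,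
    fun m h1 h2 h3 => Nat.find_min h h2 ⟨h1, h3⟩⟩

namespace StreamDecomp

variable {A : ℕ → Type} [∀ i, Fintype (A i)] {N : ∀ i, Matrix (A i) (A (i + 1)) ℝ}
  {d : ℕ} {α : Fin d → ∀ i, Finset (A i)} {P : ∀ i, Finset (A i)} {t : Fin d → ℕ}

theorem mem_pool_iff (hD : StreamDecomp N d α P t) {i : ℕ} {a : A i} :
    a ∈ P i ↔ ∀ j, a ∉ α j i := by
  rcases hD.2.1 i a with h | ⟨h, j, hj, -⟩
  · exact ⟨fun _ => h.2, fun _ => h.1⟩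
  · exact ⟨fun h' => absurd h' h, fun h' => absurd hj (h' j)⟩

theorem exists_mem (hD : StreamDecomp N d α P t) {i : ℕ} {a : A i} (h : a ∉ P i) :
    ∃ j, a ∈ α j i := by
  simpa [hD.mem_pool_iff] using h

theorem index_unique (hD : StreamDecomp N d α P t) {i : ℕ} {a : A i} {j j' : Fin d}
    (h : a ∈ α j i) (h' : a ∈ α j' i) : j = j' := by
  rcases hD.2.1 i a with h1 | ⟨-, h1⟩
  · exact absurd h (h1.2 j)
  · exact h1.unique h h'

theorem start_le (hD : StreamDecomp N d α P t) {i : ℕ} {a : A i} {j : Fin d}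
    (h : a ∈ α j i) : t j ≤ i := by
  by_contra hlt
  simp [(hD.1 j).1.1 i (not_le.1 hlt)] at h

theorem index_le_of_path (hD : StreamDecomp N d α P t) {x : ∀ i, A i} {j j' : Fin d}
    {k n : ℕ} (hkn : k ≤ n) (hx : IsPathOn N x k n) (hk : x k ∈ α j k) (hn : x n ∈ α j' n) :
    j ≤ j' := by
  induction hL : n - k using Nat.strong_induction_on generalizing k n with
  | _ L ih =>
    rcases hkn.eq_or_lt with rfl | hlt
    · exact (hD.index_unique hk hn).le
    by_cases hmid : ∃ i, k < i ∧ i < n ∧ (x i ∈ α j i ∨ x i ∈ α j' i)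
    · obtain ⟨i, h1, h2, h3 | h3⟩ := hmid
      · exact ih (n - i) (by omega) h2.le (fun l h4 h5 => hx l (by omega) h5) h3 hn rfl
      · exact ih (i - k) (by omega) h1.le (fun l h4 h5 => hx l h4 (by omega)) hk h3 rfl
    · push Not at hmid
      by_cases hjj : j = j'
      · exact hjj.le
      · exact (hD.2.2.1 j j' hjj ⟨k, n, x, hlt, hk, hn, hx, hmid⟩).le

theorem index_le_of_reach (hD : StreamDecomp N d α P t) {j j' : Fin d} {k n : ℕ} {a : A k}
    {b : A n} (h : Reach N k a n b) (ha : a ∈ α j k) (hb : b ∈ α j' n) : j ≤ j' := by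
  obtain ⟨hkn, x, rfl, rfl, hx⟩ := h
  exact hD.index_le_of_path hkn hx ha hb

/-- A path that starts and ends in a stream stays in that stream. -/
theorem mem_of_path (hD : StreamDecomp N d α P t) {x : ∀ i, A i} {j : Fin d} {k p n : ℕ}
    (hkp : k ≤ p) (hpn : p ≤ n) (hx : IsPathOn N x k n) (hk : x k ∈ α j k)
    (hn : x n ∈ α j n) : x p ∈ α j p := by
  by_cases hp : x p ∈ P p
  · exfalso
    have hkP : x k ∉ P k := fun h => hD.mem_pool_iff.1 h j hk
    have hnP : x n ∉ P n := fun h => hD.mem_pool_iff.1 h j hn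
    have hkp' : k < p := hkp.lt_of_ne (by rintro rfl; exact hkP hp)
    obtain ⟨l, hkl, hlp, hlP, hl⟩ := exists_last_lt (Q := fun i => x i ∉ P i) hkp' hkP
    obtain ⟨r, hpr, hrn, hrP, hr⟩ := exists_first_ge (Q := fun i => x i ∉ P i) hpn hnP
    have hpr' : p < r := hpr.lt_of_ne (by rintro rfl; exact hrP hp)
    obtain ⟨jl, hjl⟩ := hD.exists_mem hlP
    obtain ⟨jr, hjr⟩ := hD.exists_mem hrP
    have h1 : j ≤ jl := hD.index_le_of_reach (hx.reach le_rfl hkl (by omega)) hk hjl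
    have h2 : jr ≤ j := hD.index_le_of_reach (hx.reach (by omega) hrn le_rfl) hjr hn
    have h3 : jl < jr := (hD.2.2.2.2 p (x p) hp).2.2 jl jr
      ⟨l, x, hlp, hjl, rfl, fun m h4 h5 => not_not.1 (hl m h4 h5),
        fun i h4 h5 => hx i (by omega) (by omega)⟩
      ⟨r, x, hpr', rfl, fun m h4 h5 => not_not.1 (hr m h4 h5),
        fun i h4 h5 => hx i (by omega) (by omega), hjr⟩
    exact absurd (h3.trans_le (h2.trans h1)) (lt_irrefl _)
  · obtain ⟨i, hi⟩ := hD.exists_mem hp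
    have h1 : j ≤ i := hD.index_le_of_reach (hx.reach le_rfl hkp hpn) hk hi
    have h2 : i ≤ j := hD.index_le_of_reach (hx.reach hkp hpn le_rfl) hi hn
    rwa [le_antisymm h1 h2]

theorem mem_of_reach (hD : StreamDecomp N d α P t) {j : Fin d} {k p n : ℕ} {a : A k}
    {b : A p} {c : A n} (hab : Reach N k a p b) (hbc : Reach N p b n c) (ha : a ∈ α j k)
    (hc : c ∈ α j n) : b ∈ α j p := by
  obtain ⟨hkp, x, rfl, rfl, hx⟩ := hab
  obtain ⟨hpn, y, hy, rfl, hyp⟩ := hbc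
  obtain ⟨z, hz1, hz2⟩ := exists_splice hy.symm
  rw [← hz1 p le_rfl]
  refine hD.mem_of_path hkp hpn (x := z) (fun i h1 h2 => ?_) (by rwa [hz1 k hkp])
    (by rwa [hz2 n hpn])
  rcases lt_or_ge i p with h | h
  · rw [hz1 i h.le, hz1 (i + 1) h]
    exact hx i h1 h
  · rw [hz2 i h, hz2 (i + 1) (by omega)]
    exact hyp i h h2

/-- Every infinite path is eventually contained in one of the streams. -/
theorem eventually_mem_of_path (hD : StreamDecomp N d α P t) {x : ∀ i, A i} {k : ℕ}
    (hx : ∀ i, k ≤ i → 0 < N i (x i) (x (i + 1))) :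
    ∃ j m, ∀ i, m ≤ i → x i ∈ α j i := by
  classical
  have hfreq : ∀ m, k ≤ m → ∃ i, m ≤ i ∧ ∃ j, x i ∈ α j i := fun m hm => by
    by_contra! h
    exact hD.2.2.2.1 ⟨m, x, fun i hi => hD.mem_pool_iff.2 (h i hi),
      fun i hi => hx i (hm.trans hi)⟩
  let V : Finset (Fin d) := Finset.univ.filter fun j => ∃ i, k ≤ i ∧ x i ∈ α j i
  have hV : V.Nonempty := by
    obtain ⟨i, hi, j, hj⟩ := hfreq k le_rfl
    exact ⟨j, by simpa [V] using ⟨i, hi, hj⟩⟩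
  obtain ⟨m, hm, hmV⟩ : ∃ i, k ≤ i ∧ x i ∈ α (V.max' hV) i := by
    simpa [V] using V.max'_mem hV
  refine ⟨V.max' hV, m, fun i hi => ?_⟩
  obtain ⟨n, hn, j, hj⟩ := hfreq i (hm.trans hi)
  have h1 : V.max' hV ≤ j :=
    hD.index_le_of_reach (reach_of_path hx hm (hi.trans hn)) hmV hj
  have h2 : j ≤ V.max' hV := V.le_max' j (by simpa [V] using ⟨n, by omega, hj⟩)
  rw [← le_antisymm h1 h2] at hj
  exact hD.mem_of_reach (reach_of_path hx hm hi) (reach_of_path hx (hm.trans hi) hn) hmV hj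

/-- A vertex of a stream reaches any infinite path that is eventually in that stream. -/
theorem reach_path [∀ i, Nonempty (A i)] (hN0 : ∀ i a b, 0 ≤ N i a b)
    (hD : StreamDecomp N d α P t) {j : Fin d} {x : ∀ i, A i} {m k : ℕ} {a : A k}
    (ha : a ∈ α j k) (hx : ∀ i, m ≤ i → x i ∈ α j i) :
    ∃ n, m ≤ n ∧ k ≤ n ∧ Reach N k a n (x n) := by
  obtain ⟨y, rfl, hy, hyα⟩ := exists_path_from (fun i a => a ∈ α j i) k
    (fun i hi a ha' => by
      obtain ⟨b, hb⟩ := ((hD.1 j).2.1 i (hD.start_le ha')).1 ⟨a, ha'⟩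
      exact ⟨b.1, b.2, (hN0 i a b.1).lt_of_ne hb.symm⟩) a ha
  have hk : k ≤ max k m := le_max_left _ _
  have hyk := hyα (max k m) hk
  obtain ⟨l, -, hl⟩ := (hD.1 j).2.2 (max k m) (hD.start_le hyk)
  have hn : m ≤ max k m + l + 1 := by omega
  exact ⟨max k m + l + 1, hn, by omega, (reach_of_path hy le_rfl hk).trans
    (reach_of_matProd_subMat_pos hN0 _ l ⟨_, hyk⟩ ⟨_, hx _ hn⟩ (hl _ _))⟩

/-- Each stream of one decomposition is eventually contained in a stream of any other. -/
theorem eventually_subset [∀ i, Nonempty (A i)] (hN0 : ∀ i a b, 0 ≤ N i a b)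
    (hD : StreamDecomp N d α P t) {d' : ℕ} {α' : Fin d' → ∀ i, Finset (A i)}
    {P' : ∀ i, Finset (A i)} {t' : Fin d' → ℕ} (hD' : StreamDecomp N d' α' P' t')
    (j' : Fin d') : ∃ j m, ∀ i, m ≤ i → α' j' i ⊆ α j i := by
  have hsucc : ∀ i, ∀ a ∈ α' j' i, ∃ b, b ∈ α' j' (i + 1) ∧ 0 < N i a b := fun i a ha => by
    obtain ⟨b, hb⟩ := ((hD'.1 j').2.1 i (hD'.start_le ha)).1 ⟨a, ha⟩
    exact ⟨b.1, b.2, (hN0 i a b.1).lt_of_ne hb.symm⟩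
  obtain ⟨a₀, ha₀⟩ := (hD'.1 j').1.2 (t' j') le_rfl
  obtain ⟨y, -, hy, hyα'⟩ := exists_path_from (fun i a => a ∈ α' j' i) (t' j')
    (fun i _ => hsucc i) a₀ ha₀
  obtain ⟨j, m, hyα⟩ := hD.eventually_mem_of_path hy
  have key : ∀ (x : ∀ i, A i) (k : ℕ), (∀ i, k ≤ i → 0 < N i (x i) (x (i + 1))) →
      (∀ i, k ≤ i → x i ∈ α' j' i) → ∃ m', ∀ i, m' ≤ i → x i ∈ α j i := by
    intro x k hx hxα'
    obtain ⟨j₁, m₁, hxα⟩ := hD.eventually_mem_of_path hx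
    obtain ⟨n, hn, -, hr⟩ := hD'.reach_path hN0 (hxα' (max k m₁) (le_max_left _ _))
      (x := y) (m := max (t' j') m) fun i hi => hyα' i (by omega)
    obtain ⟨n', hn', -, hr'⟩ := hD'.reach_path hN0
      (hyα' (max (t' j') m) (le_max_left _ _)) (x := x) (m := max k m₁)
      fun i hi => hxα' i (by omega)
    have h1 := hD.index_le_of_reach hr (hxα _ (le_max_right _ _)) (hyα n (by omega))
    have h2 := hD.index_le_of_reach hr' (hyα _ (le_max_right _ _)) (hxα n' (by omega))
    rw [← le_antisymm h1 h2]
    exact ⟨m₁, hxα⟩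
  refine ⟨j, ?_⟩
  by_contra! hcon
  obtain ⟨x, hx, hxS⟩ := exists_path_of_frequently (N := N)
    (fun i a => a ∈ α' j' i ∧ a ∉ α j i) (t' j') (fun i hi b hb => by
      obtain ⟨a, ha⟩ := ((hD'.1 j').2.1 i hi).2 ⟨b, hb.1⟩
      have hab : 0 < N i a.1 b := (hN0 i a.1 b).lt_of_ne ha.symm
      refine ⟨a.1, ⟨a.2, fun haα => hb.2 ?_⟩, hab⟩
      obtain ⟨z, rfl, hz, hzα'⟩ := exists_path_from (fun i a => a ∈ α' j' i) (i + 1)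
        (fun i _ => hsucc i) b hb.1
      obtain ⟨m', hm'⟩ := key z (i + 1) hz hzα'
      exact hD.mem_of_reach (reach_of_edge hab)
        (reach_of_path hz le_rfl (le_max_left _ m')) haα (hm' _ (le_max_right _ _)))
    fun m' => by
      obtain ⟨n, hn, hns⟩ := hcon m'
      obtain ⟨b, hb, hb'⟩ := Finset.not_subset.1 hns
      exact ⟨n, hn, b, hb, hb'⟩
  obtain ⟨m', hm'⟩ := key x (t' j') hx fun i hi => (hxS i hi).1
  exact (hxS (max m' (t' j')) (le_max_right _ _)).2 (hm' _ (le_max_left _ _))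

end StreamDecomp

section Existence

variable {A : ℕ → Type}

/-- The vertex paths that start at time `0` and never end. -/
def InfPath (N : ∀ i, Matrix (A i) (A (i + 1)) ℝ) : Type :=
  {x : ∀ i, A i // ∀ i, 0 < N i (x i) (x (i + 1))}

variable {N : ∀ i, Matrix (A i) (A (i + 1)) ℝ}

theorem InfPath.reach (x : InfPath N) {k n : ℕ} (h : k ≤ n) :
    Reach N k (x.1 k) n (x.1 n) :=
  reach_of_path (k := 0) (fun i _ => x.2 i) k.zero_le h

/-- `x ≤ y` when every vertex of `x` reaches vertices of `y`. -/
instance : Preorder (InfPath N) where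
  le x y := ∀ k, ∃ n, Reach N k (x.1 k) n (y.1 n)
  le_refl x k := ⟨k, x.reach le_rfl⟩
  le_trans x y z hxy hyz k := by
    obtain ⟨n, hn⟩ := hxy k
    obtain ⟨m, hm⟩ := hyz n
    exact ⟨m, hn.trans hm⟩

theorem InfPath.le_of_frequently_reach {x y : InfPath N}
    (h : ∀ k, ∃ l, k ≤ l ∧ ∃ n, Reach N l (x.1 l) n (y.1 n)) : x ≤ y := fun k => by
  obtain ⟨l, hkl, n, hn⟩ := h k
  exact ⟨n, (x.reach hkl).trans hn⟩

theorem InfPath.le_of_frequently_eq {x y : InfPath N}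
    (h : ∀ k, ∃ l, k ≤ l ∧ x.1 l = y.1 l) : x ≤ y :=
  le_of_frequently_reach fun k => by
    obtain ⟨l, hkl, hl⟩ := h k
    exact ⟨l, hkl, l, by rw [hl]; exact y.reach le_rfl⟩

theorem finite_antisymmetrization_infPath [∀ i, Fintype (A i)]
    (bound : ∃ B : ℕ, ∀ i, Fintype.card (A i) ≤ B) :
    Finite (Antisymmetrization (InfPath N) (· ≤ ·)) := by
  classical
  obtain ⟨B, hB⟩ := bound
  by_contra hinf
  rw [not_finite_iff_infinite] at hinf
  obtain ⟨s, hs⟩ := Infinite.exists_subset_card_eq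
    (Antisymmetrization (InfPath N) (· ≤ ·)) (B + 1)
  let r : Antisymmetrization (InfPath N) (· ≤ ·) → InfPath N := ofAntisymmetrization (· ≤ ·)
  have hev : ∀ᶠ n in atTop, ∀ p ∈ s ×ˢ s, p.1 ≠ p.2 → (r p.1).1 n ≠ (r p.2).1 n := by
    rw [Finset.eventually_all]
    rintro ⟨p, q⟩ -
    by_contra hcon
    have hfreq : ∃ᶠ n in atTop, (r p).1 n = (r q).1 n ∧ p ≠ q := by
      refine (not_eventually.1 hcon).mono fun n hn => ?_
      push Not at hn
      exact ⟨hn.2, hn.1⟩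
    rw [frequently_atTop] at hfreq
    obtain ⟨-, -, -, hpq⟩ := hfreq 0
    apply hpq
    rw [← toAntisymmetrization_ofAntisymmetrization (· ≤ ·) p,
      ← toAntisymmetrization_ofAntisymmetrization (· ≤ ·) q]
    refine Quotient.sound ⟨?_, ?_⟩
    · exact InfPath.le_of_frequently_eq fun k => (hfreq k).imp fun l hl => ⟨hl.1, hl.2.1⟩
    · exact InfPath.le_of_frequently_eq fun k => (hfreq k).imp fun l hl => ⟨hl.1, hl.2.1.symm⟩
  obtain ⟨n, hn⟩ := hev.exists
  have hcard : s.card ≤ (Finset.univ : Finset (A n)).card :=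
    Finset.card_le_card_of_injOn (fun p => (r p).1 n)
      (fun _ _ => Finset.mem_coe.2 (Finset.mem_univ _))
      fun p hp q hq hpq => by
        by_contra hne
        exact hn (p, q) (Finset.mem_product.2 ⟨hp, hq⟩) hne hpq
  have := hB n
  rw [Finset.card_univ] at hcard
  omega

/-- The equivalence classes of a preorder with finitely many of them can be numbered
compatibly with the order. -/
theorem exists_numbering (X : Type*) [Preorder X] [Finite (Antisymmetrization X (· ≤ ·))] :
    ∃ (d : ℕ) (c : X → Fin d), Function.Surjective c ∧ (∀ x y, x ≤ y → c x ≤ c y) ∧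
      ∀ x y, c x = c y → x ≤ y := by
  classical
  let L := LinearExtension (Antisymmetrization X (· ≤ ·))
  have : Fintype L := Fintype.ofFinite (Antisymmetrization X (· ≤ ·))
  let e : L ≃o Fin (Fintype.card L) := (Fintype.orderIsoFinOfCardEq L rfl).symm
  refine ⟨Fintype.card L, fun x => e (toLinearExtension (toAntisymmetrization (· ≤ ·) x)),
    fun j => ?_, fun x y h => e.monotone (toLinearExtension.monotone h), fun x y h => ?_⟩
  · obtain ⟨l, rfl⟩ := e.surjective j
    obtain ⟨x, hx⟩ := Quotient.exists_rep (s := AntisymmRel.setoid X (· ≤ ·)) l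
    exact ⟨x, congrArg e hx⟩
  · exact (Quotient.exact (s := AntisymmRel.setoid X (· ≤ ·)) (e.injective h)).1

variable [∀ i, Nonempty (A i)]

theorem exists_path_to_of_col (hcol : ∀ i (b : A (i + 1)), ∃ a, 0 < N i a b) {n : ℕ}
    (b : A n) : ∃ x : ∀ i, A i, x n = b ∧ IsPathOn N x 0 n := by
  obtain ⟨x, h1, h2, -⟩ := exists_path_to (N := N) (fun _ _ => True) 0
    (fun i _ b _ => (hcol i b).imp fun a ha => ⟨trivial, ha⟩) n.zero_le b trivial
  exact ⟨x, h1, h2⟩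

/-- An infinite path starting at time `k` extends to one starting at time `0`. -/
theorem exists_infPath_of_path (hcol : ∀ i (b : A (i + 1)), ∃ a, 0 < N i a b)
    {y : ∀ i, A i} {k : ℕ} (hy : ∀ i, k ≤ i → 0 < N i (y i) (y (i + 1))) :
    ∃ x : InfPath N, ∀ i, k ≤ i → x.1 i = y i := by
  obtain ⟨x, hxk, hx⟩ := exists_path_to_of_col hcol (y k)
  obtain ⟨z, hz1, hz2⟩ := exists_splice hxk
  refine ⟨⟨z, fun i => ?_⟩, hz2⟩
  rcases lt_or_ge i k with h | h
  · rw [hz1 i h.le, hz1 (i + 1) h]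
    exact hx i i.zero_le h
  · rw [hz2 i h, hz2 (i + 1) (by omega)]
    exact hy i h

theorem exists_infPath_through (hrow : ∀ i (a : A i), ∃ b, 0 < N i a b)
    (hcol : ∀ i (b : A (i + 1)), ∃ a, 0 < N i a b) {k : ℕ} (a : A k) :
    ∃ x : InfPath N, x.1 k = a := by
  obtain ⟨y, hyk, hy, -⟩ := exists_path_from (N := N) (fun _ _ => True) k
    (fun i _ a _ => (hrow i a).imp fun b hb => ⟨trivial, hb⟩) a trivial
  obtain ⟨x, hx⟩ := exists_infPath_of_path hcol hy
  exact ⟨x, (hx k le_rfl).trans hyk⟩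

/-- A vertex that reaches a vertex of an infinite path lies on an infinite path with the same
tail. -/
theorem exists_infPath_of_reach (hcol : ∀ i (b : A (i + 1)), ∃ a, 0 < N i a b)
    {k n : ℕ} {a : A k} {x : InfPath N} (h : Reach N k a n (x.1 n)) :
    ∃ y : InfPath N, y.1 k = a ∧ ∀ i, n ≤ i → y.1 i = x.1 i := by
  obtain ⟨hkn, w, rfl, hwn, hw⟩ := h
  obtain ⟨z, hz1, hz2⟩ := exists_splice hwn
  obtain ⟨y, hy⟩ := exists_infPath_of_path (N := N) hcol (y := z) (k := k) fun i hi => by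
    rcases lt_or_ge i n with h | h
    · rw [hz1 i h.le, hz1 (i + 1) h]
      exact hw i hi h
    · rw [hz2 i h, hz2 (i + 1) (by omega)]
      exact x.2 i
  exact ⟨y, by rw [hy k le_rfl, hz1 k hkn], fun i hi => by rw [hy i (hkn.trans hi), hz2 i hi]⟩

/-- Vertices can be ranked by the least class of infinite paths through them: ranks do not
decrease along paths, every rank occurs, and each infinite path eventually has the rank of
its class. -/
theorem exists_rank [∀ i, Fintype (A i)] (bound : ∃ B : ℕ, ∀ i, Fintype.card (A i) ≤ B)
    (hrow : ∀ i (a : A i), ∃ b, 0 < N i a b) (hcol : ∀ i (b : A (i + 1)), ∃ a, 0 < N i a b) :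
    ∃ (d : ℕ) (c : InfPath N → Fin d) (rk : ∀ k, A k → Fin d),
      (∀ x y, c x = c y → x ≤ y) ∧
      (∀ k a, ∃ x : InfPath N, x.1 k = a ∧ c x = rk k a) ∧
      (∀ (x : InfPath N) k, rk k (x.1 k) ≤ c x) ∧
      (∀ k a n b, Reach N k a n b → rk k a ≤ rk n b) ∧
      (∀ x : InfPath N, ∃ m, ∀ n, m ≤ n → rk n (x.1 n) = c x) ∧
      ∀ j, ∃ k, ∃ a : A k, rk k a = j := by
  classical
  have := finite_antisymmetrization_infPath (N := N) bound
  obtain ⟨d, c, hsurj, hmono, hinj⟩ := exists_numbering (InfPath N)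
  have hrk : ∀ k (a : A k), ∃ j, (∃ x : InfPath N, x.1 k = a ∧ c x = j) ∧
      ∀ x : InfPath N, x.1 k = a → j ≤ c x := fun k a => by
    obtain ⟨x, hx⟩ := exists_infPath_through hrow hcol a
    obtain ⟨j, hj, hmin⟩ := WellFounded.has_min (wellFounded_lt (α := Fin d))
      {j | ∃ x : InfPath N, x.1 k = a ∧ c x = j} ⟨c x, x, hx, rfl⟩
    exact ⟨j, hj, fun y hy => not_lt.1 (hmin _ ⟨y, hy, rfl⟩)⟩
  choose rk hrk1 hrk2 using hrk
  have hreach : ∀ k a n b, Reach N k a n b → rk k a ≤ rk n b := by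
    intro k a n b h
    obtain ⟨x, rfl, hx⟩ := hrk1 n b
    obtain ⟨y, hyk, hy⟩ := exists_infPath_of_reach hcol h
    have hyx : y ≤ x := InfPath.le_of_frequently_eq fun l =>
      ⟨max l n, le_max_left _ _, hy _ (le_max_right _ _)⟩
    exact (hrk2 k a y hyk).trans ((hmono _ _ hyx).trans hx.le)
  have hev : ∀ x : InfPath N, ∃ m, ∀ n, m ≤ n → rk n (x.1 n) = c x := fun x => by
    obtain ⟨m, hm⟩ := WellFoundedGT.monotone_chain_condition
      (⟨fun n => rk n (x.1 n), fun k n h => hreach _ _ _ _ (x.reach h)⟩ : ℕ →o Fin d)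
    replace hm : ∀ n, m ≤ n → rk m (x.1 m) = rk n (x.1 n) := hm
    obtain ⟨z, -, hz⟩ := hrk1 m (x.1 m)
    have hxz : x ≤ z := InfPath.le_of_frequently_reach fun k => by
      obtain ⟨w, hw, hwc⟩ := hrk1 (max k m) (x.1 (max k m))
      refine ⟨max k m, le_max_left _ _, ?_⟩
      rw [← hw]
      exact hinj w z (by rw [hwc, hz, hm _ (le_max_right _ _)]) _
    refine ⟨m, fun n hn => le_antisymm (hrk2 n _ x rfl) ?_⟩
    rw [← hm n hn, ← hz]
    exact hmono _ _ hxz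
  refine ⟨d, c, rk, hinj, hrk1, fun x k => hrk2 k _ x rfl, hreach, hev, fun j => ?_⟩
  obtain ⟨x, rfl⟩ := hsurj j
  obtain ⟨m, hm⟩ := hev x
  exact ⟨m, x.1 m, hm m le_rfl⟩

theorem exists_streamDecomp [∀ i, Fintype (A i)]
    (bound : ∃ B : ℕ, ∀ i, Fintype.card (A i) ≤ B) (N : ∀ i, Matrix (A i) (A (i + 1)) ℝ)
    (hN0 : ∀ i a b, 0 ≤ N i a b) (hrow : ∀ i (a : A i), ∃ b, 0 < N i a b)
    (hcol : ∀ i (b : A (i + 1)), ∃ a, 0 < N i a b) :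
    ∃ (d : ℕ) (α : Fin d → ∀ i, Finset (A i)) (P : ∀ i, Finset (A i)) (t : Fin d → ℕ),
      StreamDecomp N d α P t := by
  classical
  obtain ⟨d, c, rk, hinj, hthr, hle, hreach, hev, hocc⟩ := exists_rank bound hrow hcol
  obtain ⟨t, ht1, ht2⟩ : ∃ t : Fin d → ℕ, (∀ j, ∃ u : A (t j), rk (t j) u = j) ∧
      ∀ k (a : A k), t (rk k a) ≤ k :=
    ⟨fun j => Nat.find (hocc j), fun j => Nat.find_spec (hocc j),
      fun k a => Nat.find_min' _ ⟨a, rfl⟩⟩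
  let α : Fin d → ∀ i, Finset (A i) := fun j i => Finset.univ.filter fun a =>
    rk i a = j ∧ ∃ u : A (t j), rk (t j) u = j ∧ Reach N (t j) u i a
  have hα : ∀ j i a, a ∈ α j i ↔
      rk i a = j ∧ ∃ u : A (t j), rk (t j) u = j ∧ Reach N (t j) u i a := fun j i a => by
    simp [α]
  have hα_reach : ∀ j k a n b, a ∈ α j k → Reach N k a n b → rk n b = j → b ∈ α j n := by
    intro j k a n b ha hab hb
    obtain ⟨-, u, hu, hua⟩ := (hα _ _ _).1 ha
    exact (hα _ _ _).2 ⟨hb, u, hu, hua.trans hab⟩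
  have hα_start : ∀ j i a, a ∈ α j i → t j ≤ i := fun j i a ha => by
    obtain ⟨-, u, -, hua⟩ := (hα _ _ _).1 ha
    exact hua.1
  have hα_path : ∀ (x : InfPath N) k, x.1 k ∈ α (c x) k → ∀ n, k ≤ n → x.1 n ∈ α (c x) n := by
    intro x k hk n hn
    refine hα_reach _ _ _ _ _ hk (x.reach hn) (le_antisymm (hle x n) ?_)
    exact ((hα _ _ _).1 hk).1.symm.le.trans (hreach _ _ _ _ (x.reach hn))
  have hα_ev : ∀ x : InfPath N, ∃ m, ∀ n, m ≤ n → x.1 n ∈ α (c x) n := fun x => by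
    obtain ⟨m, hm⟩ := hev x
    obtain ⟨u, hu⟩ := ht1 (c x)
    obtain ⟨z, hz, hzc⟩ := hthr _ u
    obtain ⟨n, hn⟩ := hinj z x (hzc.trans hu) (max (t (c x)) m)
    refine ⟨n, hα_path x n ((hα _ _ _).2 ⟨hm n ((le_max_right _ _).trans hn.1), u, hu, ?_⟩)⟩
    rw [← hz]
    exact (z.reach (le_max_left _ _)).trans hn
  let P : ∀ i, Finset (A i) := fun i => Finset.univ.filter fun a => ∀ j, a ∉ α j i
  have hP : ∀ i a, a ∈ P i ↔ ∀ j, a ∉ α j i := fun i a => by simp [P]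
  refine ⟨d, α, P, t, fun j => ⟨⟨fun i hi => ?_, fun i hi => ?_⟩, fun i hi => ⟨?_, ?_⟩,
    fun k hk => ?_⟩, fun i a => ?_, fun j j' hne h => ?_, ?_, fun k p hp => ⟨?_, ?_, ?_⟩⟩
  · exact Finset.eq_empty_of_forall_notMem fun a ha => absurd (hα_start j i a ha) (by omega)
  · obtain ⟨u, hu⟩ := ht1 j
    obtain ⟨x, rfl, hxc⟩ := hthr _ u
    obtain rfl : c x = j := hxc.trans hu
    exact ⟨x.1 i, hα_path x _ ((hα _ _ _).2 ⟨hu, _, hu, x.reach le_rfl⟩) i hi⟩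
  · rintro ⟨a, ha⟩
    obtain ⟨x, rfl, hxc⟩ := hthr _ a
    obtain rfl : c x = j := hxc.trans ((hα _ _ _).1 ha).1
    exact ⟨⟨x.1 (i + 1), hα_path x i ha _ i.le_succ⟩, (x.2 i).ne'⟩
  · rintro ⟨b, hb⟩
    obtain ⟨hbj, u, hu, -, z, rfl, rfl, hz⟩ := (hα _ _ _).1 hb
    refine ⟨⟨z i, (hα _ _ _).2 ⟨le_antisymm ?_ ?_, _, hu, hz.reach le_rfl hi i.le_succ⟩⟩,
      (hz i hi i.lt_succ_self).ne'⟩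
    · rw [← hbj]
      exact hreach _ _ _ _ (hz.reach hi i.le_succ le_rfl)
    · rw [← hu]
      exact (hreach _ _ _ _ (hz.reach le_rfl hi i.le_succ)).trans' (by rw [hu])
  · have key : ∀ v ∈ α j k, ∃ m, ∀ n, m ≤ n → ∀ w ∈ α j n, Reach N k v n w := by
      intro v hv
      by_contra! hcon
      obtain ⟨y, hy, hyS⟩ := exists_path_of_frequently (N := N)
        (fun i a => a ∈ α j i ∧ ¬ Reach N k v i a) k (fun i hi b hb => by
          obtain ⟨hbj, u, hu, -, z, rfl, rfl, hz⟩ := (hα _ _ _).1 hb.1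
          have hti : t j ≤ i := hk.trans hi
          have hedge := hz i hti i.lt_succ_self
          refine ⟨z i, ⟨(hα _ _ _).2 ⟨le_antisymm ?_ ?_, _, hu,
            hz.reach le_rfl hti i.le_succ⟩, fun h => hb.2 (h.trans (reach_of_edge hedge))⟩, hedge⟩
          · rw [← hbj]
            exact hreach _ _ _ _ (hz.reach hti i.le_succ le_rfl)
          · exact hu.symm.le.trans (hreach _ _ _ _ (hz.reach le_rfl hti i.le_succ)))
        fun m => by
          obtain ⟨n, hn, w, hw, hw'⟩ := hcon m
          exact ⟨n, hn, w, hw, hw'⟩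
      obtain ⟨x, hx⟩ := exists_infPath_of_path hcol hy
      obtain ⟨m, hm⟩ := hev x
      have hxj : c x = j := by
        rw [← hm (max k m) (le_max_right _ _), hx _ (le_max_left _ _)]
        exact ((hα _ _ _).1 (hyS _ (le_max_left _ _)).1).1
      obtain ⟨z, rfl, hzc⟩ := hthr k v
      obtain ⟨n, hn⟩ := hinj z x (by rw [hzc, hxj]; exact ((hα _ _ _).1 hv).1) k
      have hkn := hn.1
      rw [hx n hkn] at hn
      exact (hyS n hkn).2 hn
    choose! M hM using key
    refine ⟨(α j k).sup M + 1, Nat.succ_pos _, fun a b => ?_⟩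
    have hMa : M a.1 ≤ (α j k).sup M := Finset.le_sup a.2
    obtain ⟨-, z, hza, hzb, hz⟩ := hM a.1 a.2 _ (by omega) b.1 b.2
    have hzα : ∀ i, k ≤ i → i ≤ k + ((α j k).sup M + 1) + 1 → z i ∈ α j i := by
      intro i h1 h2
      have hki := hz.reach le_rfl h1 h2
      have hin := hreach _ _ _ _ (hz.reach h1 h2 le_rfl)
      rw [hza] at hki
      rw [hzb, ((hα _ _ _).1 b.2).1] at hin
      refine hα_reach _ _ _ _ _ a.2 hki (le_antisymm hin ?_)
      exact ((hα _ _ _).1 a.2).1.symm.le.trans (hreach _ _ _ _ hki)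
    have := matProd_subMat_pos hN0 k _ z hz hzα
    convert this using 1
    congr 1
    · exact Subtype.ext hza.symm
    · exact Subtype.ext hzb.symm
  · by_cases h : a ∈ P i
    · exact Or.inl ⟨h, (hP _ _).1 h⟩
    · refine Or.inr ⟨h, ?_⟩
      rw [hP] at h
      push Not at h
      obtain ⟨j, hj⟩ := h
      exact ⟨j, hj, fun j' hj' => ((hα _ _ _).1 hj').1.symm.trans ((hα _ _ _).1 hj).1⟩
  · obtain ⟨k, n, x, hkn, hk, hn, hx, -⟩ := h
    refine lt_of_le_of_ne ?_ hne
    rw [← ((hα _ _ _).1 hk).1, ← ((hα _ _ _).1 hn).1]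
    exact hreach _ _ _ _ (IsPathOn.reach hx le_rfl hkn.le le_rfl)
  · rintro ⟨k, y, hyP, hy⟩
    obtain ⟨x, hx⟩ := exists_infPath_of_path hcol hy
    obtain ⟨m, hm⟩ := hα_ev x
    have h := hm (max k m) (le_max_right _ _)
    rw [hx _ (le_max_left _ _)] at h
    exact (hP _ _).1 (hyP _ (le_max_left _ _)) _ h
  · obtain ⟨x, rfl⟩ := exists_infPath_through hrow hcol p
    obtain ⟨m, hm⟩ := hα_ev x
    have hm' : x.1 (max k m) ∉ P _ := fun h => (hP _ _).1 h _ (hm _ (le_max_right _ _))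
    obtain ⟨n, hkn, -, hn, hfirst⟩ :=
      exists_first_ge (Q := fun i => x.1 i ∉ P i) (le_max_left k m) hm'
    have hkn' : k < n := hkn.lt_of_ne (by rintro rfl; exact hn hp)
    rw [hP] at hn
    push Not at hn
    obtain ⟨j, hj⟩ := hn
    refine ⟨j, Nat.pos_of_ne_zero fun hj0 => ?_, n, x.1, hkn', rfl,
      fun l h1 h2 => not_not.1 (hfirst l h1 h2), fun i _ _ => x.2 i, hj⟩
    have hbot : ∀ i : Fin d, j ≤ i := fun i => Fin.le_def.2 (by omega)
    have hrkp : rk k (x.1 k) = j := by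
      refine le_antisymm ?_ (hbot _)
      rw [← ((hα _ _ _).1 hj).1]
      exact hreach _ _ _ _ (x.reach hkn)
    have htk : t j ≤ k := hrkp ▸ ht2 k (x.1 k)
    refine (hP _ _).1 hp j ((hα _ _ _).2 ⟨hrkp, x.1 (t j), ?_, x.reach htk⟩)
    exact le_antisymm ((hreach _ _ _ _ (x.reach htk)).trans hrkp.le) (hbot _)
  · rintro j hj0 ⟨n, x, hkn, rfl, -, hx, hn⟩
    have hbot : ∀ i : Fin d, j ≤ i := fun i => Fin.le_def.2 (by omega)
    have hrkp : rk k (x k) = j := by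
      refine le_antisymm ?_ (hbot _)
      rw [← ((hα _ _ _).1 hn).1]
      exact hreach _ _ _ _ (IsPathOn.reach hx le_rfl hkn.le le_rfl)
    have htk : t j ≤ k := hrkp ▸ ht2 k (x k)
    obtain ⟨z, hzk, hz⟩ := exists_path_to_of_col hcol (x k)
    have hr := hz.reach (t j).zero_le htk le_rfl
    rw [hzk] at hr
    refine (hP _ _).1 hp j ((hα _ _ _).2 ⟨hrkp, z (t j), ?_, hr⟩)
    exact le_antisymm ((hreach _ _ _ _ hr).trans hrkp.le) (hbot _)
  · rintro j j' ⟨k', x, hk, hxk', rfl, -, hx⟩ ⟨n, y, hkn, hyk, -, hy, hn⟩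
    have hjp := IsPathOn.reach hx le_rfl hk.le le_rfl
    have hpj := IsPathOn.reach hy le_rfl hkn.le le_rfl
    rw [hyk] at hpj
    have h1 := hreach _ _ _ _ hjp
    have h2 := hreach _ _ _ _ hpj
    rw [((hα _ _ _).1 hxk').1] at h1
    rw [((hα _ _ _).1 hn).1] at h2
    refine lt_of_le_of_ne (h1.trans h2) ?_
    rintro rfl
    exact (hP _ _).1 hp j (hα_reach _ _ _ _ _ hxk' hjp (le_antisymm h2 h1))

end Existence

/-- Stream Decomposition Theorem: a reduced sequence of nonnegative real
matrices with nonempty alphabets of bounded cardinality admits a decomposition into finitely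
many reduced primitive proper streams plus a pool stream satisfying (i)–(iii), and (iv) this
decomposition is eventually unique up to an order-compatible renumbering of the streams. -/
theorem statement3 (A : ℕ → Type) [∀ i, Fintype (A i)] [∀ i, Nonempty (A i)]
    (bound : ∃ B : ℕ, ∀ i, Fintype.card (A i) ≤ B)
    (N : ∀ i, Matrix (A i) (A (i + 1)) ℝ)
    (hN0 : ∀ i a b, 0 ≤ N i a b)
    (hrow : ∀ i (a : A i), ∃ b, N i a b ≠ 0)
    (hcol : ∀ i (b : A (i + 1)), ∃ a, N i a b ≠ 0) :
    ∃ (d : ℕ) (α : Fin d → ∀ i, Finset (A i)) (P : ∀ i, Finset (A i)) (t : Fin d → ℕ),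
      StreamDecomp N d α P t ∧
      ∀ (d' : ℕ) (α' : Fin d' → ∀ i, Finset (A i)) (P' : ∀ i, Finset (A i))
        (t' : Fin d' → ℕ), StreamDecomp N d' α' P' t' →
        d' = d ∧ ∃ (m : ℕ) (σ : Fin d → Fin d'), Function.Bijective σ ∧
          (∀ j, ∀ i, m ≤ i → α' (σ j) i = α j i) ∧ ∀ i, m ≤ i → P' i = P i := by
  classical
  have hcol' : ∀ i (b : A (i + 1)), ∃ a, 0 < N i a b := fun i b =>
    (hcol i b).imp fun a ha => lt_of_le_of_ne (hN0 i a b) (Ne.symm ha)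
  have hrow' : ∀ i (a : A i), ∃ b, 0 < N i a b := fun i a =>
    (hrow i a).imp fun b hb => lt_of_le_of_ne (hN0 i a b) (Ne.symm hb)
  obtain ⟨d, α, P, t, hD⟩ := exists_streamDecomp bound N hN0 hrow' hcol'
  refine ⟨d, α, P, t, hD, fun d' α' P' t' hD' => ?_⟩
  choose f mf hf using hD.eventually_subset hN0 hD'
  choose g mg hg using hD'.eventually_subset hN0 hD
  have hfg : ∀ j, f (g j) = j := fun j => by
    let n := max (max (mf (g j)) (mg j)) (t j)
    obtain ⟨a, ha⟩ := (hD.1 j).1.2 n (le_max_right _ _)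
    exact hD.index_unique
      (hf (g j) n (by omega) (hg j n (by omega) ha)) ha
  have hgf : ∀ j, g (f j) = j := fun j => by
    let n := max (max (mg (f j)) (mf j)) (t' j)
    obtain ⟨a, ha⟩ := (hD'.1 j).1.2 n (le_max_right _ _)
    exact hD'.index_unique
      (hg (f j) n (by omega) (hf j n (by omega) ha)) ha
  have hbij : Function.Bijective g :=
    Function.bijective_iff_has_inverse.2 ⟨f, hfg, hgf⟩
  refine ⟨by simpa using (Fintype.card_of_bijective hbij).symm, ?_⟩
  let m := Finset.univ.sup fun j => max (mg j) (mf (g j))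
  have hm : ∀ j, mg j ≤ m ∧ mf (g j) ≤ m := fun j => by
    have := Finset.le_sup (f := fun j => max (mg j) (mf (g j))) (Finset.mem_univ j)
    exact ⟨(le_max_left _ _).trans this, (le_max_right _ _).trans this⟩
  have heq : ∀ j, ∀ i, m ≤ i → α' (g j) i = α j i := fun j i hi => by
    refine Finset.Subset.antisymm ?_ (hg j i ((hm j).1.trans hi))
    simpa only [hfg] using hf (g j) i ((hm j).2.trans hi)
  refine ⟨m, g, hbij, heq, fun i hi => ?_⟩
  ext a
  rw [hD'.mem_pool_iff, hD.mem_pool_iff, hbij.2.forall]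
  simp only [heq _ i hi]
end
end

section
/- Let M = (M_i)_{i≥0} be a sequence of nonnegative integer matrices with nonempty alphabets of sizes l_i = #A_i. Then the set of extreme points of the compact convex set V_M^Δ has cardinality at most liminf_{n→∞} l_n; in particular it is finite whenever liminf_{n→∞} l_n is finite. -/
open Filter Topology Matrix

noncomputable section

section

variable {A : ℕ → Type} [∀ i, Fintype (A i)]

/-- The shift `(w_i)_i ↦ (M_i w_{i+1})_i`, whose nonnegative fixed points form `V0 M`. -/
def pullback (M : ∀ i, Matrix (A i) (A (i + 1)) ℝ) :
    (∀ i, A i → ℝ) →ₗ[ℝ] (∀ i, A i → ℝ) where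
  toFun w i := (M i).mulVec (w (i + 1))
  map_add' v w := by
    funext i
    exact Matrix.mulVec_add (M i) (v (i + 1)) (w (i + 1))
  map_smul' c w := by
    funext i
    exact Matrix.mulVec_smul (M i) c (w (i + 1))

/-- The sum of the entries of the initial vector. -/
def initialMass (A : ℕ → Type) [∀ i, Fintype (A i)] : (∀ i, A i → ℝ) →ₗ[ℝ] ℝ where
  toFun w := ∑ a, w 0 a
  map_add' v w := by simp [Finset.sum_add_distrib]
  map_smul' c w := by simp [Finset.mul_sum]

variable {M : ∀ i, Matrix (A i) (A (i + 1)) ℝ}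

lemma pullback_apply (w : ∀ i, A i → ℝ) (i : ℕ) :
    pullback M w i = (M i).mulVec (w (i + 1)) := rfl

lemma initialMass_apply (w : ∀ i, A i → ℝ) : initialMass A w = ∑ a, w 0 a := rfl

lemma continuous_pullback : Continuous (pullback M) := by
  refine continuous_pi fun i => ?_
  exact Continuous.matrix_mulVec continuous_const (continuous_apply (i + 1))

lemma continuous_initialMass : Continuous (initialMass A) := by
  change Continuous fun w : ∀ i, A i → ℝ => ∑ a, w 0 a
  fun_prop

lemma initialMass_mono {v w : ∀ i, A i → ℝ} (h : v 0 ≤ w 0) :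
    initialMass A v ≤ initialMass A w :=
  Finset.sum_le_sum fun a _ => h a

lemma initialMass_nonneg {v : ∀ i, A i → ℝ} (h : 0 ≤ v) : 0 ≤ initialMass A v :=
  Finset.sum_nonneg fun a _ => h 0 a

lemma pullback_apply_le (hM : ∀ i a b, 0 ≤ M i a b) {v w : ∀ i, A i → ℝ} {i : ℕ}
    (h : v (i + 1) ≤ w (i + 1)) : pullback M v i ≤ pullback M w i := fun a =>
  Finset.sum_le_sum fun b _ => mul_le_mul_of_nonneg_left (h b) (hM i a b)

lemma pullback_mono (hM : ∀ i a b, 0 ≤ M i a b) : Monotone (pullback M) := fun _ _ h i =>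
  pullback_apply_le hM (h (i + 1))

lemma pullback_pow_apply_zero_le (hM : ∀ i a b, 0 ≤ M i a b) (m : ℕ) :
    ∀ {v w : ∀ i, A i → ℝ}, v m ≤ w m → (pullback M ^ m) v 0 ≤ (pullback M ^ m) w 0 := by
  induction m with
  | zero => intro v w h; simpa using h
  | succ m ih =>
    intro v w h
    rw [pow_succ, Module.End.mul_apply, Module.End.mul_apply]
    exact ih (pullback_apply_le hM h)

lemma pullback_pow_of_fixed {v : ∀ i, A i → ℝ} (h : pullback M v = v) (m : ℕ) :
    (pullback M ^ m) v = v := by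
  induction m with
  | zero => simp
  | succ m ih => rw [pow_succ, Module.End.mul_apply, h, ih]

lemma mem_V0_iff {w : ∀ i, A i → ℝ} : w ∈ V0 M ↔ 0 ≤ w ∧ pullback M w = w :=
  ⟨fun h => ⟨fun i a => h.1 i a, funext fun i => (h.2 i).symm⟩,
    fun h => ⟨fun i a => h.1 i a, fun i => (congrFun h.2 i).symm⟩⟩

lemma eq_zero_of_fixed {w : ∀ i, A i → ℝ} (h : pullback M w = w) (i : ℕ) (hi : w i = 0) :
    w 0 = 0 := by
  induction i with
  | zero => exact hi
  | succ i ih =>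
    refine ih ?_
    rw [← h, pullback_apply, hi, Matrix.mulVec_zero]

lemma mem_VDelta_iff {w : ∀ i, A i → ℝ} :
    w ∈ VDelta M ↔ 0 ≤ w ∧ pullback M w = w ∧ initialMass A w = 1 := by
  have habs (hw : 0 ≤ w) : ∑ a, |w 0 a| = initialMass A w :=
    Finset.sum_congr rfl fun a _ => abs_of_nonneg (hw 0 a)
  constructor
  · rintro ⟨⟨h, -⟩, hs⟩
    obtain ⟨h0, hf⟩ := mem_V0_iff.1 h
    exact ⟨h0, hf, by rw [← habs h0, hs]⟩
  · rintro ⟨h0, hf, hs⟩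
    refine ⟨⟨mem_V0_iff.2 ⟨h0, hf⟩, fun i hi => ?_⟩, by rw [habs h0, hs]⟩
    rw [initialMass_apply, eq_zero_of_fixed hf i hi] at hs
    simp at hs

/-- An extreme point of `VDelta M` dominates no nonzero fixed point of zero initial mass. -/
lemma eq_zero_of_le_extremePoint {v u : ∀ i, A i → ℝ}
    (hv : v ∈ Set.extremePoints ℝ (VDelta M)) (hu : u ∈ V0 M) (huv : u ≤ v)
    (hs : initialMass A u = 0) : u = 0 := by
  obtain ⟨hu0, huf⟩ := mem_V0_iff.1 hu
  obtain ⟨hv0, hvf, hvs⟩ := mem_VDelta_iff.1 hv.1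
  have h₁ : v - u ∈ VDelta M :=
    mem_VDelta_iff.2 ⟨sub_nonneg.2 huv, by rw [map_sub, hvf, huf],
      by rw [map_sub, hvs, hs, sub_zero]⟩
  have h₂ : v + u ∈ VDelta M :=
    mem_VDelta_iff.2 ⟨add_nonneg hv0 hu0, by rw [map_add, hvf, huf],
      by rw [map_add, hvs, hs, add_zero]⟩
  have h := hv.2 h₁ h₂ ⟨1 / 2, 1 / 2, by norm_num, by norm_num, by norm_num, by module⟩
  simpa using h

/-- Extreme points of `VDelta M` span extreme rays of the cone `V0 M`. -/
lemma eq_smul_of_le_extremePoint {v u : ∀ i, A i → ℝ}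
    (hv : v ∈ Set.extremePoints ℝ (VDelta M)) (hu : u ∈ V0 M) (huv : u ≤ v) :
    u = initialMass A u • v := by
  obtain ⟨hu0, huf⟩ := mem_V0_iff.1 hu
  obtain ⟨hv0, hvf, hvs⟩ := mem_VDelta_iff.1 hv.1
  have hd0 : 0 ≤ v - u := sub_nonneg.2 huv
  have hdf : pullback M (v - u) = v - u := by rw [map_sub, hvf, huf]
  have hds : initialMass A (v - u) = 1 - initialMass A u := by rw [map_sub, hvs]
  have hs1 := initialMass_nonneg hd0
  rw [hds] at hs1
  rcases (initialMass_nonneg hu0).eq_or_lt with hs | hs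
  · rw [← hs, zero_smul]
    exact eq_zero_of_le_extremePoint hv hu huv hs.symm
  rcases hs1.eq_or_lt with ht | ht
  · have h := eq_zero_of_le_extremePoint hv (mem_V0_iff.2 ⟨hd0, hdf⟩) (sub_le_self v hu0)
      (by rw [hds, ← ht])
    rw [← sub_eq_zero.1 h, hvs, one_smul]
  · set s := initialMass A u
    have h₁ : s⁻¹ • u ∈ VDelta M :=
      mem_VDelta_iff.2 ⟨smul_nonneg (inv_nonneg.2 hs.le) hu0, by rw [map_smul, huf],
        by rw [map_smul, smul_eq_mul, inv_mul_cancel₀ hs.ne']⟩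
    have h₂ : (1 - s)⁻¹ • (v - u) ∈ VDelta M :=
      mem_VDelta_iff.2 ⟨smul_nonneg (inv_nonneg.2 ht.le) hd0, by rw [map_smul, hdf],
        by rw [map_smul, smul_eq_mul, hds, inv_mul_cancel₀ ht.ne']⟩
    have h := hv.2 h₁ h₂ ⟨s, 1 - s, hs, ht, by ring, by
      rw [smul_inv_smul₀ hs.ne', smul_inv_smul₀ ht.ne', add_sub_cancel]⟩
    rw [← h, smul_inv_smul₀ hs.ne']

/-- The pullbacks of a nonnegative supersolution decrease to a fixed point. -/
lemma exists_tendsto_pullback_pow (hM : ∀ i a b, 0 ≤ M i a b) {y : ∀ i, A i → ℝ}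
    (h0 : 0 ≤ y) (hy : pullback M y ≤ y) :
    ∃ h ∈ V0 M, h ≤ y ∧ Tendsto (fun m => (pullback M ^ m) y) atTop (𝓝 h) := by
  have hanti : Antitone fun m => (pullback M ^ m) y := by
    refine antitone_nat_of_succ_le fun m => ?_
    induction m with
    | zero => simpa using hy
    | succ m ih =>
      simp only [pow_succ' _ (m + 1), pow_succ' _ m, Module.End.mul_apply] at ih ⊢
      exact pullback_mono hM ih
  have hnonneg (m : ℕ) : 0 ≤ (pullback M ^ m) y := by
    induction m with
    | zero => simpa using h0
    | succ m ih =>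
      rw [pow_succ', Module.End.mul_apply, ← map_zero (pullback M)]
      exact pullback_mono hM ih
  let h : ∀ i, A i → ℝ := fun i a => ⨅ m, (pullback M ^ m) y i a
  have hlim : Tendsto (fun m => (pullback M ^ m) y) atTop (𝓝 h) := by
    refine tendsto_pi_nhds.2 fun i => tendsto_pi_nhds.2 fun a => ?_
    refine tendsto_atTop_ciInf (fun m n hmn => hanti hmn i a) ⟨0, ?_⟩
    rintro _ ⟨m, rfl⟩
    exact hnonneg m i a
  have hfix : pullback M h = h := by
    refine tendsto_nhds_unique ((continuous_pullback.tendsto h).comp hlim) ?_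
    refine (hlim.comp (tendsto_add_atTop_nat 1)).congr fun m => ?_
    simp [pow_succ', Module.End.mul_apply]
  have hle : h ≤ y := by
    refine le_of_tendsto' hlim fun m => ?_
    simpa using hanti (Nat.zero_le m)
  exact ⟨h, mem_V0_iff.2 ⟨ge_of_tendsto' hlim hnonneg, hfix⟩, hle, hlim⟩

/-- Distinct extreme points are asymptotically disjoint. -/
lemma tendsto_initialMass_pullback_pow_inf (hM : ∀ i a b, 0 ≤ M i a b) {v w : ∀ i, A i → ℝ}
    (hv : v ∈ Set.extremePoints ℝ (VDelta M)) (hw : w ∈ Set.extremePoints ℝ (VDelta M))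
    (hvw : v ≠ w) :
    Tendsto (fun m => initialMass A ((pullback M ^ m) (v ⊓ w))) atTop (𝓝 0) := by
  obtain ⟨hv0, hvf, -⟩ := mem_VDelta_iff.1 hv.1
  obtain ⟨hw0, hwf, -⟩ := mem_VDelta_iff.1 hw.1
  obtain ⟨h, hh, hle, hlim⟩ := exists_tendsto_pullback_pow hM (le_inf hv0 hw0)
    (le_inf ((pullback_mono hM inf_le_left).trans hvf.le)
      ((pullback_mono hM inf_le_right).trans hwf.le))
  have hmass : initialMass A h = 0 := by
    by_contra hne
    have e₁ := eq_smul_of_le_extremePoint hv hh (hle.trans inf_le_left)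
    have e₂ := eq_smul_of_le_extremePoint hw hh (hle.trans inf_le_right)
    exact hvw (smul_right_injective _ hne (e₁.symm.trans e₂))
  rw [← hmass]
  exact (continuous_initialMass.tendsto h).comp hlim

lemma le_sum_inf_of_le_sum {ι : Type*} (s : Finset ι) {x : ℝ} {y : ι → ℝ} (hx : 0 ≤ x)
    (hy : ∀ j ∈ s, 0 ≤ y j) (hle : x ≤ ∑ j ∈ s, y j) : x ≤ ∑ j ∈ s, x ⊓ y j := by
  by_cases h : ∃ j ∈ s, x ≤ y j
  · obtain ⟨j, hj, hxj⟩ := h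
    calc x = x ⊓ y j := (inf_eq_left.2 hxj).symm
      _ ≤ ∑ j ∈ s, x ⊓ y j :=
        Finset.single_le_sum (f := fun j => x ⊓ y j) (fun i hi => le_inf hx (hy i hi)) hj
  · push Not at h
    refine hle.trans (Finset.sum_le_sum fun j hj => le_inf (h j hj).le le_rfl)

/-- If the vectors at level `m` of finitely many elements of `VDelta M` are linearly dependent,
then one of them has total overlap at least `1` with the others. -/
lemma exists_one_le_sum_initialMass_inf (hM : ∀ i a b, 0 ≤ M i a b) {ι : Type*} [Fintype ι]
    [DecidableEq ι] {v : ι → ∀ i, A i → ℝ} (hv : ∀ j, v j ∈ VDelta M) {m : ℕ}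
    (hdep : ¬ LinearIndependent ℝ fun j => v j m) :
    ∃ i, 1 ≤ ∑ j ∈ Finset.univ.erase i, initialMass A ((pullback M ^ m) (v i ⊓ v j)) := by
  obtain ⟨c, hc, j₀, hj₀⟩ := Fintype.not_linearIndependent_iff.1 hdep
  obtain ⟨i, -, hi⟩ := Finset.exists_max_image Finset.univ (fun j => |c j|) ⟨j₀, Finset.mem_univ _⟩
  have hci : 0 < |c i| := (abs_pos.2 hj₀).trans_le (hi j₀ (Finset.mem_univ _))
  refine ⟨i, ?_⟩
  have hnn (j : ι) (a : A m) : 0 ≤ v j m a := (mem_VDelta_iff.1 (hv j)).1 m a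
  have hle (a : A m) : v i m a ≤ ∑ j ∈ Finset.univ.erase i, v j m a := by
    have hca : ∑ j, c j * v j m a = 0 := by simpa using congrFun hc a
    rw [← Finset.add_sum_erase _ _ (Finset.mem_univ i)] at hca
    refine le_of_mul_le_mul_left ?_ hci
    calc |c i| * v i m a = |∑ j ∈ Finset.univ.erase i, c j * v j m a| := by
          rw [← abs_neg (∑ j ∈ _, _), ← eq_neg_of_add_eq_zero_left hca, abs_mul,
            abs_of_nonneg (hnn i a)]
      _ ≤ ∑ j ∈ Finset.univ.erase i, |c j * v j m a| := Finset.abs_sum_le_sum_abs _ _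
      _ ≤ ∑ j ∈ Finset.univ.erase i, |c i| * v j m a := by
          refine Finset.sum_le_sum fun j _ => ?_
          rw [abs_mul, abs_of_nonneg (hnn j a)]
          exact mul_le_mul_of_nonneg_right (hi j (Finset.mem_univ _)) (hnn j a)
      _ = |c i| * ∑ j ∈ Finset.univ.erase i, v j m a := (Finset.mul_sum _ _ _).symm
  have hlev : v i m ≤ (∑ j ∈ Finset.univ.erase i, v i ⊓ v j) m := fun a => by
    rw [Finset.sum_apply, Finset.sum_apply]
    exact le_sum_inf_of_le_sum _ (hnn i a) (fun j _ => hnn j a) (hle a)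
  obtain ⟨-, hf, hs⟩ := mem_VDelta_iff.1 (hv i)
  calc 1 = initialMass A ((pullback M ^ m) (v i)) := by rw [pullback_pow_of_fixed hf, hs]
    _ ≤ initialMass A ((pullback M ^ m) (∑ j ∈ Finset.univ.erase i, v i ⊓ v j)) :=
        initialMass_mono (pullback_pow_apply_zero_le hM m hlev)
    _ = _ := by rw [map_sum, map_sum]

/-- Finitely many distinct extreme points are linearly independent at every high level. -/
lemma eventually_linearIndependent (hM : ∀ i a b, 0 ≤ M i a b) {ι : Type*} [Fintype ι]
    {v : ι → ∀ i, A i → ℝ} (hv : ∀ j, v j ∈ Set.extremePoints ℝ (VDelta M))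
    (hinj : Function.Injective v) :
    ∀ᶠ m in atTop, LinearIndependent ℝ fun j => v j m := by
  classical
  have hsmall (i : ι) : ∀ᶠ m in atTop,
      ∑ j ∈ Finset.univ.erase i, initialMass A ((pullback M ^ m) (v i ⊓ v j)) < 1 := by
    have h : Tendsto (fun m => ∑ j ∈ Finset.univ.erase i,
        initialMass A ((pullback M ^ m) (v i ⊓ v j))) atTop (𝓝 (∑ _j ∈ Finset.univ.erase i, 0)) :=
      tendsto_finsetSum _ fun j hj => tendsto_initialMass_pullback_pow_inf hM (hv i) (hv j)
        fun e => Finset.ne_of_mem_erase hj (hinj e).symm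
    rw [Finset.sum_const_zero] at h
    exact h.eventually_lt_const one_pos
  filter_upwards [eventually_all.2 hsmall] with m hm
  by_contra hdep
  obtain ⟨i, hi⟩ := exists_one_le_sum_initialMass_inf hM (fun j => (hv j).1) hdep
  exact (hm i).not_ge hi

lemma encard_extremePoints_VDelta_le (hM : ∀ i a b, 0 ≤ M i a b) :
    (Set.extremePoints ℝ (VDelta M)).encard ≤
      Filter.liminf (fun n => (Fintype.card (A n) : ℕ∞)) Filter.atTop := by
  refine ENat.forall_natCast_le_iff_le.1 fun k hk => ?_
  obtain ⟨t, ht, htk⟩ := Set.exists_subset_encard_eq hk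
  have : Fintype t := (Set.finite_of_encard_eq_coe htk).fintype
  refine le_liminf_of_le (by isBoundedDefault) ?_
  filter_upwards [eventually_linearIndependent hM (v := fun x : t => x.1) (fun x => ht x.2)
    Subtype.val_injective] with m hm
  rw [← htk, Set.encard_eq_coe_toFinset_card, Set.toFinset_card]
  have := hm.fintype_card_le_finrank
  rw [Module.finrank_fintype_fun_eq_card] at this
  exact_mod_cast this

end

/-- for a sequence `M` of nonnegative integer matrices with nonempty alphabets of
sizes `l_i = #A_i`, the set of extreme points of the compact convex set `V_M^Δ` has cardinality
at most `liminf l_n`; in particular it is finite whenever `liminf l_n` is finite. -/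
theorem statement11 (A : ℕ → Type) [∀ i, Fintype (A i)] [∀ i, Nonempty (A i)]
    (M : ∀ i, Matrix (A i) (A (i + 1)) ℝ)
    (hint : ∀ i a b, ∃ n : ℕ, M i a b = (n : ℝ)) :
    (Set.extremePoints ℝ (VDelta M)).encard ≤
      Filter.liminf (fun n => (Fintype.card (A n) : ℕ∞)) Filter.atTop ∧
    (Filter.liminf (fun n => (Fintype.card (A n) : ℕ∞)) Filter.atTop < ⊤ →
      (Set.extremePoints ℝ (VDelta M)).Finite) := by
  have hM : ∀ i a b, 0 ≤ M i a b := fun i a b => by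
    obtain ⟨n, hn⟩ := hint i a b
    exact hn ▸ n.cast_nonneg
  have hle := encard_extremePoints_VDelta_le hM
  exact ⟨hle, fun h => Set.encard_lt_top_iff.1 (hle.trans_lt h)⟩
end
end
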